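/- arXiv:0806.3150 — 2 statements merged into one kernel-verified Lean document; each statement's English description precedes it below -/
import Mathlib

section
/- For every a > 1/2 and ε ∈ (0,1) there exist a constant c > 0 and N₀ such that for all integers N ≥ N₀ and all p, q ∈ [1,∞] with 1/p + 2/q = 2, the function v_N(t,x) := √(2π/log N) · (2π)^{−2} ∫_{1<|ξ|<e^{−a}N} |ξ|^{−2} cos(−t√(1+|ξ|²) + ξ·x) dξ satisfies ( ∫_{ε/(4N)}^{ε/(2N)} ‖f(v_N(t,·))‖_{L^q({ε/(4N) ≤ |x| ≤ ε/(2N)})}^p dt )^{1/p} ≥ c √(log N) (with the usual essential-supremum interpretation when p or q equals ∞). -/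
open MeasureTheory Real Classical
open scoped ENNReal RealInnerProductSpace

noncomputable section

/-- The plane `ℝ²`. -/
abbrev Plane := EuclideanSpace ℝ (Fin 2)

/-- Pointwise norm of the (full) gradient of `u`. -/
def gradNorm (u : Plane → ℝ) (x : Plane) : ℝ := ‖fderiv ℝ u x‖

/-- The `L^p` norm for a real (finite) exponent `p`. -/
def LpNorm (p : ℝ) (u : Plane → ℝ) : ℝ := (∫ x : Plane, |u x| ^ p) ^ (1 / p)

/-- The sup (`L^∞`) norm. -/
def supNorm (u : Plane → ℝ) : ℝ := ⨆ x : Plane, |u x|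

/-- The homogeneous Hölder seminorm `[u]_α`. -/
def holderSemi (α : ℝ) (u : Plane → ℝ) : ℝ :=
  ⨆ p : Plane × Plane,
    if p.1 = p.2 then 0 else |u p.1 - u p.2| / ‖p.1 - p.2‖ ^ α

/-- The Hölder norm `‖u‖_{C^α} = sup |u| + [u]_α`. -/
def holderNorm (α : ℝ) (u : Plane → ℝ) : ℝ := supNorm u + holderSemi α u

/-- `u` is `α`-Hölder continuous. -/
def IsHolder (α : ℝ) (u : Plane → ℝ) : Prop :=
  ∃ C : ℝ, 0 ≤ C ∧ ∀ x y : Plane, |u x - u y| ≤ C * ‖x - y‖ ^ α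

/-- The squared `H¹` norm `‖∇u‖_{L²}² + ‖u‖_{L²}²`. -/
def H1Sq (u : Plane → ℝ) : ℝ :=
  (∫ x : Plane, gradNorm u x ^ 2) + ∫ x : Plane, u x ^ 2

/-- The squared local `H¹` norm `‖u‖_{H¹[R]}²`. -/
def H1locSq (R : ℝ) (u : Plane → ℝ) : ℝ :=
  ⨆ c : Plane, ∫ x in Metric.closedBall c R, (gradNorm u x ^ 2 + u x ^ 2)

/-- Membership in `H¹(ℝ²)` (with classical derivatives). -/
def MemH1 (u : Plane → ℝ) : Prop :=
  Differentiable ℝ u ∧ Integrable (fun x => u x ^ 2) ∧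
    Integrable (fun x => gradNorm u x ^ 2)

/-- The nonlinearity `f(u) = (e^{4π u²} - 1 - 4π u²) u`. -/
def f (s : ℝ) : ℝ := (Real.exp (4 * π * s ^ 2) - 1 - 4 * π * s ^ 2) * s

/-- The potential `F(u) = (1/8π)(e^{4π u²} - 1 - 4π u² - 8π² u⁴)`. -/
def F (s : ℝ) : ℝ :=
  (8 * π)⁻¹ * (Real.exp (4 * π * s ^ 2) - 1 - 4 * π * s ^ 2 - 8 * π ^ 2 * s ^ 4)

/-- The frequency annulus `1 < |ξ| < e^{-a} N`. -/
def freqSet (a N : ℝ) : Set Plane := {ξ | 1 < ‖ξ‖ ∧ ‖ξ‖ < Real.exp (-a) * N}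

/-- The concentrating family of radial free Klein–Gordon solutions `v_N`. -/
def vKG (a : ℝ) (N : ℕ) (t : ℝ) (x : Plane) : ℝ :=
  Real.sqrt (2 * π / Real.log N) * (2 * π) ^ (-2 : ℤ) *
    ∫ ξ in freqSet a N, ‖ξ‖ ^ (-2 : ℤ) *
      Real.cos (-t * Real.sqrt (1 + ‖ξ‖ ^ 2) + ⟪ξ, x⟫)

/-- The `L²`-mass of `‖ξ‖⁻¹` over the annulus `1 < ‖ξ‖ < R`. -/
lemma integral_annulus_norm_zpow_neg_two {R : ℝ} (hR : 1 ≤ R) :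
    ∫ ξ in {ξ : Plane | 1 < ‖ξ‖ ∧ ‖ξ‖ < R}, ‖ξ‖ ^ (-2 : ℤ) = 2 * π * Real.log R := by
  have hm : MeasurableSet {ξ : Plane | 1 < ‖ξ‖ ∧ ‖ξ‖ < R} :=
    (measurableSet_lt measurable_const measurable_norm).inter
      (measurableSet_lt measurable_norm measurable_const)
  have hind : {ξ : Plane | 1 < ‖ξ‖ ∧ ‖ξ‖ < R}.indicator (fun ξ => ‖ξ‖ ^ (-2 : ℤ)) =
      fun ξ : Plane => (Set.Ioo 1 R).indicator (fun y : ℝ => y ^ (-2 : ℤ)) ‖ξ‖ := by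
    ext ξ
    simp only [Set.indicator, Set.mem_ofPred_eq, Set.mem_Ioo]
  have hball : (volume : Measure Plane).real (Metric.ball 0 1) = π := by
    simp [Measure.real, EuclideanSpace.volume_ball_fin_two, Real.pi_pos.le]
  have hradial : ∀ y : ℝ, y ^ (2 - 1) • (Set.Ioo 1 R).indicator (fun y : ℝ => y ^ (-2 : ℤ)) y =
      (Set.Ioo 1 R).indicator (fun y : ℝ => y⁻¹) y := by
    intro y
    by_cases hy : y ∈ Set.Ioo 1 R
    · have : y ≠ 0 := by linarith [hy.1]
      rw [Set.indicator_of_mem hy, Set.indicator_of_mem hy, zpow_neg, smul_eq_mul]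
      norm_cast
      field_simp
      simp
    · simp [Set.indicator_of_notMem hy]
  rw [← integral_indicator hm, hind, integral_fun_norm_addHaar, hball, finrank_euclideanSpace_fin]
  simp_rw [hradial]
  rw [setIntegral_indicator measurableSet_Ioo,
    Set.inter_eq_self_of_subset_right fun y hy => Set.mem_Ioi.2 (one_pos.trans hy.1),
    ← integral_Ioc_eq_integral_Ioo, ← intervalIntegral.integral_of_le hR,
    integral_inv_of_pos one_pos (by linarith)]
  simp [mul_assoc]

lemma measurableSet_freqSet (a N : ℝ) : MeasurableSet (freqSet a N) :=
  (measurableSet_lt measurable_const measurable_norm).inter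
    (measurableSet_lt measurable_norm measurable_const)

lemma freqSet_subset_ball (a N : ℝ) : freqSet a N ⊆ Metric.ball 0 (Real.exp (-a) * N) := by
  intro ξ hξ
  simpa using hξ.2

lemma volume_freqSet_lt_top (a N : ℝ) : volume (freqSet a N) < ∞ :=
  (measure_mono (freqSet_subset_ball a N)).trans_lt measure_ball_lt_top

lemma volume_real_freqSet_le (a : ℝ) {N : ℝ} (hN : 0 ≤ N) :
    volume.real (freqSet a N) ≤ (Real.exp (-a) * N) ^ 2 * π := by
  refine (measureReal_mono (freqSet_subset_ball a N) measure_ball_lt_top.ne).trans ?_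
  have : 0 ≤ Real.exp (-a) * N := by positivity
  rw [Measure.real, EuclideanSpace.volume_ball_fin_two, ENNReal.toReal_mul, ENNReal.toReal_pow,
    ENNReal.toReal_ofReal this]
  simp [Real.pi_pos.le]

/-- The integrand of `vKG`. -/
def kgIntegrand (t : ℝ) (x ξ : Plane) : ℝ :=
  ‖ξ‖ ^ (-2 : ℤ) * Real.cos (-t * Real.sqrt (1 + ‖ξ‖ ^ 2) + ⟪ξ, x⟫)

lemma norm_zpow_neg_two_le_one {a N : ℝ} {ξ : Plane} (hξ : ξ ∈ freqSet a N) :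
    ‖ξ‖ ^ (-2 : ℤ) ≤ 1 := by
  rw [zpow_neg]
  exact inv_le_one_of_one_le₀ (one_le_zpow₀ hξ.1.le (by norm_num))

lemma norm_kgIntegrand_le {a N : ℝ} (t : ℝ) (x : Plane) {ξ : Plane} (hξ : ξ ∈ freqSet a N) :
    ‖kgIntegrand t x ξ‖ ≤ 1 := by
  rw [kgIntegrand, norm_mul, Real.norm_of_nonneg (by positivity : (0 : ℝ) ≤ ‖ξ‖ ^ (-2 : ℤ))]
  exact mul_le_one₀ (norm_zpow_neg_two_le_one hξ) (norm_nonneg _) (Real.abs_cos_le_one _)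

lemma integrableOn_freqSet_of_norm_le_one {a N : ℝ} {g : Plane → ℝ} (hg : Measurable g)
    (h : ∀ ξ ∈ freqSet a N, ‖g ξ‖ ≤ 1) : IntegrableOn g (freqSet a N) :=
  Measure.integrableOn_of_bounded (volume_freqSet_lt_top a N).ne hg.aestronglyMeasurable
    ((ae_restrict_iff' (measurableSet_freqSet a N)).2 (.of_forall h))

lemma integrableOn_kgIntegrand (a N t : ℝ) (x : Plane) :
    IntegrableOn (kgIntegrand t x) (freqSet a N) :=
  integrableOn_freqSet_of_norm_le_one (by unfold kgIntegrand; fun_prop)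
    fun _ hξ => norm_kgIntegrand_le t x hξ

lemma le_kgIntegrand {N t : ℝ} (hN : 0 < N) {x ξ : Plane} (hξ : 1 < ‖ξ‖) (ht : |t| ≤ 1 / (2 * N))
    (hx : ‖x‖ ≤ 1 / (2 * N)) :
    ‖ξ‖ ^ (-2 : ℤ) - 2 / N ^ 2 ≤ kgIntegrand t x ξ := by
  set r := ‖ξ‖
  set θ := -t * Real.sqrt (1 + r ^ 2) + ⟪ξ, x⟫ with hθ
  have hs : Real.sqrt (1 + r ^ 2) ≤ 2 * r := Real.sqrt_le_iff.2 ⟨by linarith, by nlinarith⟩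
  have h_abs : |θ| ≤ 3 * r * (1 / (2 * N)) := by
    calc |θ| ≤ |-t * Real.sqrt (1 + r ^ 2)| + |⟪ξ, x⟫| := abs_add_le _ _
      _ ≤ 1 / (2 * N) * (2 * r) + r * (1 / (2 * N)) := by
        gcongr
        · rw [abs_mul, abs_neg, abs_of_nonneg (Real.sqrt_nonneg _)]
          gcongr
        · exact (abs_real_inner_le_norm ξ x).trans (by gcongr)
      _ = _ := by ring
  have hsq : θ ^ 2 ≤ 4 * r ^ 2 / N ^ 2 := by
    calc θ ^ 2 = |θ| ^ 2 := (sq_abs θ).symm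
      _ ≤ (3 * r * (1 / (2 * N))) ^ 2 := by gcongr
      _ = (9 / 4) * (r ^ 2 / N ^ 2) := by field_simp; norm_num
      _ ≤ 4 * (r ^ 2 / N ^ 2) := by gcongr; norm_num
      _ = _ := by ring
  have hr : (0 : ℝ) < r := by linarith
  calc r ^ (-2 : ℤ) - 2 / N ^ 2 = r ^ (-2 : ℤ) * (1 - 4 * r ^ 2 / N ^ 2 / 2) := by
        rw [zpow_neg]
        norm_cast
        field_simp
        ring
    _ ≤ r ^ (-2 : ℤ) * (1 - θ ^ 2 / 2) := by gcongr
    _ ≤ r ^ (-2 : ℤ) * Real.cos θ := by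
        gcongr
        exact Real.one_sub_sq_div_two_le_cos
    _ = kgIntegrand t x ξ := rfl

lemma le_setIntegral_kgIntegrand {a N t : ℝ} (ha : 0 ≤ a) (hN : 0 < N) (haN : a ≤ Real.log N)
    {x : Plane} (ht : |t| ≤ 1 / (2 * N)) (hx : ‖x‖ ≤ 1 / (2 * N)) :
    2 * π * (Real.log N - (a + 1)) ≤ ∫ ξ in freqSet a N, kgIntegrand t x ξ := by
  have hR : 1 ≤ Real.exp (-a) * N := by
    rw [Real.exp_neg, ← div_eq_inv_mul, one_le_div (Real.exp_pos a)]
    exact (Real.le_log_iff_exp_le hN).1 haN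
  have hint : IntegrableOn (fun ξ : Plane => ‖ξ‖ ^ (-2 : ℤ)) (freqSet a N) := by
    refine integrableOn_freqSet_of_norm_le_one (by fun_prop) fun ξ hξ => ?_
    rw [Real.norm_of_nonneg (by positivity)]
    exact norm_zpow_neg_two_le_one hξ
  have hconst : IntegrableOn (fun _ : Plane => 2 / N ^ 2) (freqSet a N) :=
    integrableOn_const (volume_freqSet_lt_top a N).ne
  have hlog : Real.log (Real.exp (-a) * N) = Real.log N - a := by
    rw [Real.log_mul (Real.exp_ne_zero _) hN.ne', Real.log_exp]
    ring
  have hvol : volume.real (freqSet a N) * (2 / N ^ 2) ≤ 2 * π := by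
    calc volume.real (freqSet a N) * (2 / N ^ 2)
        ≤ (Real.exp (-a) * N) ^ 2 * π * (2 / N ^ 2) := by
          gcongr
          exact volume_real_freqSet_le a hN.le
      _ = Real.exp (-a) ^ 2 * (2 * π) := by field_simp
      _ ≤ 1 * (2 * π) := by
          gcongr
          exact pow_le_one₀ (Real.exp_pos _).le (Real.exp_le_one_iff.2 (by linarith))
      _ = 2 * π := one_mul _
  calc 2 * π * (Real.log N - (a + 1))
      ≤ 2 * π * Real.log (Real.exp (-a) * N) - volume.real (freqSet a N) * (2 / N ^ 2) := by
        rw [hlog]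
        linarith
    _ = ∫ ξ in freqSet a N, (‖ξ‖ ^ (-2 : ℤ) - 2 / N ^ 2) := by
        rw [integral_sub hint hconst, setIntegral_const, smul_eq_mul]
        exact congrArg (· - _) (integral_annulus_norm_zpow_neg_two hR).symm
    _ ≤ ∫ ξ in freqSet a N, kgIntegrand t x ξ :=
        setIntegral_mono_on (hint.sub hconst) (integrableOn_kgIntegrand a N t x)
          (measurableSet_freqSet a N) fun ξ hξ => le_kgIntegrand hN hξ.1 ht hx

lemma le_vKG {a t : ℝ} {N : ℕ} (ha : 0 ≤ a) (hN : 0 < N) (haN : a ≤ Real.log N)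
    {x : Plane} (ht : |t| ≤ 1 / (2 * N)) (hx : ‖x‖ ≤ 1 / (2 * N)) :
    Real.sqrt (2 * π / Real.log N) * (2 * π)⁻¹ * (Real.log N - (a + 1)) ≤ vKG a N t x := by
  have hN' : (0 : ℝ) < N := by exact_mod_cast hN
  calc _ = Real.sqrt (2 * π / Real.log N) * (2 * π) ^ (-2 : ℤ) *
        (2 * π * (Real.log N - (a + 1))) := by
        rw [zpow_neg]
        norm_cast
        field_simp
    _ ≤ _ := by
        unfold vKG
        gcongr
        exact le_setIntegral_kgIntegrand ha hN' haN ht hx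

lemma abs_vKG_le (a t : ℝ) (N : ℕ) (x : Plane) :
    |vKG a N t x| ≤ Real.sqrt (2 * π / Real.log N) * (2 * π) ^ (-2 : ℤ) *
      volume.real (freqSet a N) := by
  have h : ‖∫ ξ in freqSet a N, kgIntegrand t x ξ‖ ≤ 1 * volume.real (freqSet a N) :=
    norm_setIntegral_le_of_norm_le_const (volume_freqSet_lt_top a N)
      fun ξ hξ => norm_kgIntegrand_le t x hξ
  rw [one_mul] at h
  have hc : 0 ≤ Real.sqrt (2 * π / Real.log N) * (2 * π) ^ (-2 : ℤ) := by positivity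
  unfold vKG
  rw [abs_mul, abs_of_nonneg hc]
  exact mul_le_mul_of_nonneg_left h hc

lemma half_exp_le_exp_sub {s : ℝ} (hs : 5 ≤ s) : Real.exp s / 2 ≤ Real.exp s - 1 - s := by
  have h := Real.quadratic_le_exp_of_nonneg (by linarith : 0 ≤ s)
  nlinarith

lemma abs_f_le {s M : ℝ} (h : |s| ≤ M) :
    |f s| ≤ (Real.exp (4 * π * M ^ 2) + 1 + 4 * π * M ^ 2) * M := by
  have hM : 0 ≤ M := (abs_nonneg s).trans h
  have hsq : s ^ 2 ≤ M ^ 2 := by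
    rw [← sq_abs s]
    gcongr
  rw [f, abs_mul]
  gcongr
  have h1 : Real.exp (4 * π * s ^ 2) ≤ Real.exp (4 * π * M ^ 2) := by gcongr
  have h2 : 4 * π * s ^ 2 ≤ 4 * π * M ^ 2 := by gcongr
  have h3 : 0 ≤ 4 * π * s ^ 2 := by positivity
  have h4 := Real.exp_pos (4 * π * s ^ 2)
  rw [abs_le]
  constructor <;> linarith

/-- Lower bound for `f` at the height reached by `vKG`, with `L = log N`. -/
lemma le_f_of_le {K L v : ℝ} (hK : 0 ≤ K) (hL : 2 * K + 3 ≤ L)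
    (hv : Real.sqrt (2 * π / L) * (2 * π)⁻¹ * (L - K) ≤ v) :
    Real.exp (-4 * K) / 12 * Real.exp (2 * L) * Real.sqrt L ≤ f v := by
  have hL0 : 0 < L := by linarith
  have hπ := Real.pi_pos
  have hlow : 0 ≤ Real.sqrt (2 * π / L) * (2 * π)⁻¹ * (L - K) :=
    mul_nonneg (by positivity) (by linarith)
  have hv0 : 0 ≤ v := hlow.trans hv
  have hsq : (L - K) ^ 2 / (2 * π * L) ≤ v ^ 2 := by
    calc (L - K) ^ 2 / (2 * π * L) = (Real.sqrt (2 * π / L) * (2 * π)⁻¹ * (L - K)) ^ 2 := by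
          rw [mul_pow, mul_pow, Real.sq_sqrt (by positivity)]
          field_simp
      _ ≤ v ^ 2 := by gcongr
  have hs : 2 * L - 4 * K ≤ 4 * π * v ^ 2 := by
    calc 2 * L - 4 * K ≤ 2 * (L - K) ^ 2 / L := by
          rw [le_div_iff₀ hL0]
          nlinarith [sq_nonneg K]
      _ = 4 * π * ((L - K) ^ 2 / (2 * π * L)) := by field_simp; ring
      _ ≤ 4 * π * v ^ 2 := by gcongr
  have hvL : Real.sqrt L / 6 ≤ v := by
    refine abs_le_of_sq_le_sq' ?_ hv0 |>.2
    rw [div_pow, Real.sq_sqrt hL0.le]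
    refine le_trans ?_ hsq
    rw [div_le_div_iff₀ (by norm_num) (by positivity)]
    nlinarith [Real.pi_lt_four, mul_pos hL0 hL0]
  calc Real.exp (-4 * K) / 12 * Real.exp (2 * L) * Real.sqrt L
      = Real.exp (2 * L - 4 * K) / 2 * (Real.sqrt L / 6) := by
        rw [show 2 * L - 4 * K = -4 * K + 2 * L by ring, Real.exp_add]
        ring
    _ ≤ Real.exp (4 * π * v ^ 2) / 2 * v := by gcongr
    _ ≤ f v := by
        unfold f
        gcongr
        exact half_exp_le_exp_sub (by linarith)

lemma volume_closed_annulus {r s : ℝ} (hr : 0 ≤ r) (hrs : r ≤ s) :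
    volume {x : Plane | r ≤ ‖x‖ ∧ ‖x‖ ≤ s} = ENNReal.ofReal ((s ^ 2 - r ^ 2) * π) := by
  have hset : {x : Plane | r ≤ ‖x‖ ∧ ‖x‖ ≤ s} = Metric.closedBall 0 s \ Metric.ball 0 r := by
    ext x
    simp [and_comm]
  have hsub : (Metric.ball 0 r : Set Plane) ⊆ Metric.closedBall 0 s :=
    Metric.ball_subset_closedBall.trans (Metric.closedBall_subset_closedBall hrs)
  rw [hset, measure_sdiff hsub measurableSet_ball.nullMeasurableSet measure_ball_lt_top.ne,
    EuclideanSpace.volume_ball_fin_two, EuclideanSpace.volume_closedBall_fin_two,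
    ← ENNReal.ofReal_pow (hr.trans hrs), ← ENNReal.ofReal_pow hr,
    ← ENNReal.ofReal_mul (by positivity), ← ENNReal.ofReal_mul (by positivity),
    ← ENNReal.ofReal_sub _ (by positivity)]
  congr 1
  ring

lemma ofReal_mul_rpow_le_eLpNorm {α : Type*} [MeasurableSpace α] {μ : Measure α} {p : ℝ≥0∞}
    (hp : p ≠ 0) {g : α → ℝ} {G m : ℝ} (hG : 0 ≤ G) (hm : 0 < m)
    (hμ : μ Set.univ = ENNReal.ofReal m) (h : ∀ᵐ x ∂μ, G ≤ g x) :
    ENNReal.ofReal (G * m ^ (1 / p.toReal)) ≤ eLpNorm g p μ := by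
  have hμ0 : μ ≠ 0 := by
    rintro rfl
    simp [hm.not_ge, eq_comm] at hμ
  calc ENNReal.ofReal (G * m ^ (1 / p.toReal)) = eLpNorm (fun _ : α => G) p μ := by
        rw [eLpNorm_const G hp hμ0, hμ, ENNReal.ofReal_mul hG, Real.enorm_of_nonneg hG,
          ENNReal.ofReal_rpow_of_pos hm]
    _ ≤ eLpNorm g p μ := by
        refine eLpNorm_mono_ae ?_
        filter_upwards [h] with x hx
        rw [Real.norm_of_nonneg hG, Real.norm_of_nonneg (hG.trans hx)]
        exact hx

lemma scaling_identity {n B D α β : ℝ} (hn : 0 < n) (hB : 0 ≤ B) (hD : 0 ≤ D)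
    (h : α + 2 * β = 2) :
    n ^ 2 * (B / n ^ 2) ^ β * (D / n) ^ α = B ^ β * D ^ α := by
  have key : (n ^ 2) ^ β * n ^ α = n ^ 2 := by
    rw [← Real.rpow_natCast n 2, ← Real.rpow_mul hn.le, ← Real.rpow_add hn]
    congr 1
    push_cast
    linarith
  rw [Real.div_rpow hB (by positivity), Real.div_rpow hD hn.le]
  have h1 : (n ^ 2) ^ β ≠ 0 := (Real.rpow_pos_of_pos (by positivity) _).ne'
  have h2 : n ^ α ≠ 0 := (Real.rpow_pos_of_pos hn _).ne'
  calc n ^ 2 * (B ^ β / (n ^ 2) ^ β) * (D ^ α / n ^ α)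
      = n ^ 2 / ((n ^ 2) ^ β * n ^ α) * (B ^ β * D ^ α) := by field_simp
    _ = _ := by rw [key, div_self (by positivity), one_mul]

lemma one_div_toReal_le_one {p : ℝ≥0∞} (hp : 1 ≤ p) : 1 / p.toReal ≤ 1 := by
  rw [one_div, ← ENNReal.toReal_inv]
  exact ENNReal.toReal_le_of_le_ofReal zero_le_one (by simpa using hp)

lemma one_div_toReal_add {p q : ℝ≥0∞} (hp : 1 ≤ p) (hq : 1 ≤ q) (h : 1 / p + 2 / q = 2) :
    1 / p.toReal + 2 * (1 / q.toReal) = 2 := by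
  have hp0 : p ≠ 0 := (zero_lt_one.trans_le hp).ne'
  have hq0 : q ≠ 0 := (zero_lt_one.trans_le hq).ne'
  have := congrArg ENNReal.toReal h
  rw [ENNReal.toReal_add (ENNReal.div_ne_top (by simp) hp0) (ENNReal.div_ne_top (by simp) hq0),
    ENNReal.toReal_div, ENNReal.toReal_div] at this
  simp only [ENNReal.toReal_one, ENNReal.toReal_ofNat] at this
  rwa [mul_one_div]

/-- failure of the uniform dual Strichartz control of the nonlinearity. -/
theorem statement16 (a ε : ℝ) (ha : 1/2 < a) (hε : ε ∈ Set.Ioo (0:ℝ) 1) :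
    ∃ c : ℝ, 0 < c ∧ ∃ N₀ : ℕ, ∀ N : ℕ, N₀ ≤ N →
      ∀ p q : ℝ≥0∞, 1 ≤ p → 1 ≤ q → 1 / p + 2 / q = 2 →
        ENNReal.ofReal (c * Real.sqrt (Real.log N)) ≤
          eLpNorm (fun t : ℝ =>
              (eLpNorm (fun x : Plane => f (vKG a N t x)) q
                (volume.restrict
                  {x : Plane | ε / (4 * N) ≤ ‖x‖ ∧ ‖x‖ ≤ ε / (2 * N)})).toReal)
            p (volume.restrict (Set.Icc (ε / (4 * N)) (ε / (2 * N)))) := by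
  obtain ⟨hε0, hε1⟩ := hε
  have hπ := Real.pi_pos
  set K := a + 1 with hK
  set A := Real.exp (-4 * K) / 12 with hA
  set B := 3 * π * ε ^ 2 / 16 with hB
  set D := ε / 4 with hD
  have hA0 : 0 < A := by positivity
  have hB0 : 0 < B := by positivity
  have hD0 : 0 < D := by positivity
  have hB1 : B ≤ 1 := by
    have : ε ^ 2 ≤ 1 := pow_le_one₀ hε0.le hε1.le
    have : π * ε ^ 2 ≤ 4 * 1 := by gcongr; exact Real.pi_le_four
    rw [hB]
    linarith
  have hD1 : D ≤ 1 := by linarith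
  obtain ⟨N₁, hN₁⟩ := Filter.eventually_atTop.1
    ((Real.tendsto_log_atTop.comp tendsto_natCast_atTop_atTop).eventually_ge_atTop (2 * K + 3))
  refine ⟨A * B * D, by positivity, max N₁ 1, fun N hN p q hp hq hpq => ?_⟩
  have hL : 2 * K + 3 ≤ Real.log N := hN₁ N ((le_max_left _ _).trans hN)
  have hN0 : 0 < N := (le_max_right N₁ 1).trans hN
  have hn : (0 : ℝ) < N := by exact_mod_cast hN0
  set S := {x : Plane | ε / (4 * N) ≤ ‖x‖ ∧ ‖x‖ ≤ ε / (2 * N)} with hS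
  set I := Set.Icc (ε / (4 * N)) (ε / (2 * N)) with hI
  have hSm : MeasurableSet S :=
    (measurableSet_le measurable_const measurable_norm).inter
      (measurableSet_le measurable_norm measurable_const)
  have hle : ε / (4 * N) ≤ ε / (2 * N) := by gcongr; norm_num
  have hε2 : ε / (2 * N) ≤ 1 / (2 * N) := by gcongr
  have hSvol : volume.restrict S Set.univ = ENNReal.ofReal (B / (N : ℝ) ^ 2) := by
    rw [Measure.restrict_apply_univ, volume_closed_annulus (by positivity) hle]
    congr 1
    rw [hB]
    field_simp
    norm_num
  have hIvol : volume.restrict I Set.univ = ENNReal.ofReal (D / N) := by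
    rw [Measure.restrict_apply_univ, Real.volume_Icc]
    congr 1
    rw [hD]
    field_simp
    norm_num
  have hexp : Real.exp (2 * Real.log N) = (N : ℝ) ^ 2 := by
    rw [two_mul, Real.exp_add, Real.exp_log hn, sq]
  set G := A * (N : ℝ) ^ 2 * Real.sqrt (Real.log N) with hG
  have hG0 : 0 ≤ G := by positivity
  have hf : ∀ t ∈ I, ∀ x ∈ S, G ≤ f (vKG a N t x) := by
    intro t ht x hx
    have ht0 : 0 ≤ t := le_trans (by positivity) ht.1
    rw [hG, ← hexp]
    refine le_f_of_le (by linarith) hL (le_vKG (by linarith) hN0 (by linarith) ?_ ?_)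
    · rw [abs_of_nonneg ht0]
      exact ht.2.trans hε2
    · exact hx.2.trans hε2
  have hinner : ∀ t ∈ I, G * (B / (N : ℝ) ^ 2) ^ (1 / q.toReal) ≤
      (eLpNorm (fun x : Plane => f (vKG a N t x)) q (volume.restrict S)).toReal := by
    intro t ht
    refine (ENNReal.ofReal_le_iff_le_toReal ?_).1
      (ofReal_mul_rpow_le_eLpNorm (zero_lt_one.trans_le hq).ne' hG0 (by positivity) hSvol
        ((ae_restrict_iff' hSm).2 (.of_forall (hf t ht))))
    refine ((eLpNorm_le_of_ae_bound (.of_forall fun x => abs_f_le (abs_vKG_le a t N x))).trans_lt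
      (ENNReal.mul_lt_top (ENNReal.rpow_lt_top_of_nonneg (by positivity) ?_)
        ENNReal.ofReal_lt_top)).ne
    rw [hSvol]
    exact ENNReal.ofReal_ne_top
  refine le_trans (ENNReal.ofReal_le_ofReal ?_)
    (ofReal_mul_rpow_le_eLpNorm (zero_lt_one.trans_le hp).ne' (by positivity) (by positivity)
      hIvol ((ae_restrict_iff' measurableSet_Icc).2 (.of_forall hinner)))
  have hBq : B ≤ B ^ (1 / q.toReal) :=
    Real.self_le_rpow_of_le_one hB0.le hB1 (one_div_toReal_le_one hq)
  have hDp : D ≤ D ^ (1 / p.toReal) :=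
    Real.self_le_rpow_of_le_one hD0.le hD1 (one_div_toReal_le_one hp)
  calc A * B * D * Real.sqrt (Real.log N)
      = A * Real.sqrt (Real.log N) * (B * D) := by ring
    _ ≤ A * Real.sqrt (Real.log N) * (B ^ (1 / q.toReal) * D ^ (1 / p.toReal)) := by gcongr
    _ = A * Real.sqrt (Real.log N) * ((N : ℝ) ^ 2 * (B / (N : ℝ) ^ 2) ^ (1 / q.toReal) *
          (D / N) ^ (1 / p.toReal)) := by
        rw [scaling_identity hn hB0.le hD0.le (one_div_toReal_add hp hq hpq)]
    _ = G * (B / (N : ℝ) ^ 2) ^ (1 / q.toReal) * (D / N) ^ (1 / p.toReal) := by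
        rw [hG]
        ring
end
end

section
/- Let H ∈ (0,1) and M > 0, and set μ := min(1, √((1−H)/M)). There exist δ ∈ (0,1) and a constant C > 0 such that for every continuously differentiable u : ℝ² → ℂ with u, ∇u ∈ L²(ℝ²), ‖∇u‖²_{L²} ≤ H, ‖u‖²_{L²} ≤ M, u ∈ L^{4/δ}(ℝ²), ∇u ∈ L^{2/(1−δ)}(ℝ²), and u (1/2−δ/2)-Hölder continuous, one has ‖∇(f∘u)‖_{L^{1/(1−δ)}(ℝ²)} ≤ C ‖∇u‖_{L^{2/(1−δ)}} ‖u‖²_{L^{4/δ}} · max(1, ‖u‖_{C^{1/2−δ/2}})². -/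
open MeasureTheory Real Classical
open scoped ENNReal RealInnerProductSpace

noncomputable section

/-- Pointwise norm of the gradient of a complex-valued function. -/
def gradNormC (u : Plane → ℂ) (x : Plane) : ℝ := ‖fderiv ℝ u x‖

/-- The nonlinearity `f(u) = (e^{4π|u|²} - 1 - 4π|u|²) u` for complex `u`. -/
def fC (z : ℂ) : ℂ :=
  ((Real.exp (4 * π * ‖z‖ ^ 2) - 1 - 4 * π * ‖z‖ ^ 2 : ℝ) : ℂ) * z

/-- The potential `F(u)` for complex `u`. -/
def FC (z : ℂ) : ℝ :=
  (8 * π)⁻¹ *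
    (Real.exp (4 * π * ‖z‖ ^ 2) - 1 - 4 * π * ‖z‖ ^ 2 - 8 * π ^ 2 * ‖z‖ ^ 4)

/-- `u` is `α`-Hölder continuous (complex-valued version). -/
def IsHolderC (α : ℝ) (u : Plane → ℂ) : Prop :=
  ∃ C : ℝ, 0 ≤ C ∧ ∀ x y : Plane, ‖u x - u y‖ ≤ C * ‖x - y‖ ^ α

/-- The Hölder norm `‖u‖_{C^α}` (complex-valued version). -/
def holderNormC (α : ℝ) (u : Plane → ℂ) : ℝ :=
  (⨆ x : Plane, ‖u x‖) +
    ⨆ p : Plane × Plane,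
      if p.1 = p.2 then 0 else ‖u p.1 - u p.2‖ / ‖p.1 - p.2‖ ^ α

/-- The point of the plane with polar coordinates `p`. -/
def ray (p : ℝ × ℝ) : Plane := !₂[p.1 * Real.cos p.2, p.1 * Real.sin p.2]

lemma continuous_ray : Continuous ray := by
  unfold ray
  refine (PiLp.continuous_toLp 2 _).comp (continuous_pi fun i => ?_)
  fin_cases i <;> simp <;> fun_prop

lemma lintegral_polar {F : Plane → ℝ≥0∞} (hF : Measurable F) (x : Plane) :
    ∫⁻ p in Set.Ioi (0:ℝ) ×ˢ Set.Ioo (-π) π, ENNReal.ofReal p.1 * F (x + ray p) =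
      ∫⁻ y, F y := by
  have h2 : MeasurePreserving (fun p : ℝ × ℝ => (!₂[p.1, p.2] : Plane)) :=
    (PiLp.volume_preserving_toLp (Fin 2)).comp (volume_preserving_finTwoArrow ℝ).symm
  have h3 := h2.lintegral_comp (f := fun y => F (x + y)) (hF.comp (measurable_const_add x))
  rw [← lintegral_add_left_eq_self F x]
  refine Eq.trans ?_ h3
  rw [← lintegral_comp_polarCoord_symm]
  rfl

lemma lintegral_mul_le_sqrt {α : Type*} [MeasurableSpace α] {μ : Measure α} {F G : α → ℝ≥0∞}
    (hF : AEMeasurable F μ) (hG : AEMeasurable G μ) :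
    ∫⁻ a, F a * G a ∂μ ≤
      (∫⁻ a, F a ^ 2 ∂μ) ^ (1 / 2 : ℝ) * (∫⁻ a, G a ^ 2 ∂μ) ^ (1 / 2 : ℝ) := by
  have := ENNReal.lintegral_mul_le_Lp_mul_Lq μ Real.HolderConjugate.two_two hF hG
  simpa only [ENNReal.rpow_two, Pi.mul_apply] using this

lemma lintegral_ray_le {F : Plane → ℝ≥0∞} (hF : Measurable F) (x : Plane) {a b : ℝ}
    (ha : 0 < a) (hab : a ≤ b) :
    ∫⁻ p in Set.Ioc a b ×ˢ Set.Ioo (-π) π, F (x + ray p) ≤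
      (∫⁻ y, F y ^ 2) ^ (1 / 2 : ℝ) *
        ENNReal.ofReal (2 * π * Real.log (b / a)) ^ (1 / 2 : ℝ) := by
  have hFm : Measurable fun p : ℝ × ℝ => F (x + ray p) :=
    hF.comp ((measurable_const_add x).comp continuous_ray.measurable)
  have hms : MeasurableSet (Set.Ioc a b ×ˢ Set.Ioo (-π) π) :=
    measurableSet_Ioc.prod measurableSet_Ioo
  have hsm : Measurable fun p : ℝ × ℝ => ENNReal.ofReal (√p.1) :=
    (Real.continuous_sqrt.measurable.comp measurable_fst).ennreal_ofReal
  have him : Measurable fun p : ℝ × ℝ => ENNReal.ofReal (√p.1)⁻¹ :=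
    (Real.continuous_sqrt.measurable.comp measurable_fst).inv.ennreal_ofReal
  calc ∫⁻ p in Set.Ioc a b ×ˢ Set.Ioo (-π) π, F (x + ray p)
      = ∫⁻ p in Set.Ioc a b ×ˢ Set.Ioo (-π) π,
          (ENNReal.ofReal (√p.1) * F (x + ray p)) * ENNReal.ofReal (√p.1)⁻¹ := by
        refine setLIntegral_congr_fun hms fun p hp => ?_
        have h0 : 0 < √p.1 := Real.sqrt_pos.2 (ha.trans hp.1.1)
        rw [mul_comm (ENNReal.ofReal _), mul_assoc, ← ENNReal.ofReal_mul h0.le,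
          mul_inv_cancel₀ h0.ne', ENNReal.ofReal_one, mul_one]
    _ ≤ _ := lintegral_mul_le_sqrt (hsm.mul hFm).aemeasurable him.aemeasurable
    _ ≤ _ := by
        refine mul_le_mul' (ENNReal.rpow_le_rpow ?_ (by norm_num))
          (ENNReal.rpow_le_rpow ?_ (by norm_num))
        · calc ∫⁻ p in Set.Ioc a b ×ˢ Set.Ioo (-π) π,
                (ENNReal.ofReal (√p.1) * F (x + ray p)) ^ 2
              = ∫⁻ p in Set.Ioc a b ×ˢ Set.Ioo (-π) π,
                  ENNReal.ofReal p.1 * F (x + ray p) ^ 2 := by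
                refine setLIntegral_congr_fun hms fun p hp => ?_
                beta_reduce
                rw [mul_pow, ← ENNReal.ofReal_pow (Real.sqrt_nonneg _),
                  Real.sq_sqrt (ha.trans hp.1.1).le]
            _ ≤ ∫⁻ p in Set.Ioi (0:ℝ) ×ˢ Set.Ioo (-π) π,
                  ENNReal.ofReal p.1 * F (x + ray p) ^ 2 :=
                lintegral_mono_set (Set.prod_mono_left fun r hr => ha.trans hr.1)
            _ = _ := lintegral_polar (hF.pow_const 2) x
        · refine le_of_eq ?_
          calc ∫⁻ p in Set.Ioc a b ×ˢ Set.Ioo (-π) π, ENNReal.ofReal (√p.1)⁻¹ ^ 2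
              = ∫⁻ p in Set.Ioc a b ×ˢ Set.Ioo (-π) π, ENNReal.ofReal p.1⁻¹ * 1 := by
                refine setLIntegral_congr_fun hms fun p hp => ?_
                rw [← ENNReal.ofReal_pow (by positivity), inv_pow,
                  Real.sq_sqrt (ha.trans hp.1.1).le, mul_one]
            _ = (∫⁻ s in Set.Ioc a b, ENNReal.ofReal s⁻¹) * ∫⁻ _ in Set.Ioo (-π) π, 1 := by
                rw [Measure.volume_eq_prod, ← Measure.prod_restrict]
                exact lintegral_prod_mul (f := fun s : ℝ => ENNReal.ofReal s⁻¹)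
                  (g := fun _ : ℝ => (1 : ℝ≥0∞)) (by fun_prop) (by fun_prop)
            _ = ENNReal.ofReal (Real.log (b / a)) * ENNReal.ofReal (2 * π) := by
                congr 1
                · rw [← integral_inv_of_pos ha (ha.trans_le hab),
                    intervalIntegral.integral_of_le hab,
                    ofReal_integral_eq_lintegral_ofReal]
                  · refine ((continuousOn_inv₀.mono fun s hs => ?_).integrableOn_Icc).mono_set
                      Set.Ioc_subset_Icc_self
                    exact (ha.trans_le hs.1).ne'
                  · filter_upwards [ae_restrict_mem measurableSet_Ioc] with s hs
                    exact inv_nonneg.2 (ha.trans hs.1).le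
                · rw [setLIntegral_one, Real.volume_Ioo]
                  congr 1; ring
            _ = _ := by
                rw [← ENNReal.ofReal_mul (Real.log_nonneg ((one_le_div ha).2 hab))]
                congr 1; ring

lemma enorm_le_add_lintegral_ray {u : Plane → ℂ} (hu : ContDiff ℝ 1 u) (x : Plane) {r θ : ℝ}
    (hr : 0 ≤ r) :
    ‖u x‖ₑ ≤ ‖u (x + ray (r, θ))‖ₑ +
      ∫⁻ s in Set.Ioc 0 r, ‖fderiv ℝ u (x + ray (s, θ))‖ₑ := by
  have hray : ∀ s, ray (s, θ) = s • ray (1, θ) := by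
    intro s; ext i; fin_cases i <;> simp [ray]
  have hn : ‖ray (1, θ)‖ = 1 := by
    simp [ray, EuclideanSpace.norm_eq]
  set e := ray (1, θ)
  have hline : ∀ s, HasDerivAt (fun s : ℝ => u (x + s • e)) (fderiv ℝ u (x + s • e) e) s := by
    intro s
    have h1 : HasDerivAt (fun s : ℝ => x + s • e) e s := by
      simpa using ((hasDerivAt_id s).smul_const e).const_add x
    exact ((hu.differentiable (by norm_num)) _).hasFDerivAt.comp_hasDerivAt s h1
  have hc : ContDiff ℝ 1 (fun s : ℝ => u (x + s • e)) := by fun_prop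
  have key := enorm_sub_le_lintegral_deriv_of_contDiffOn_Icc hc.contDiffOn hr
  simp only [zero_smul, add_zero] at key
  calc ‖u x‖ₑ = ‖u (x + r • e) - (u (x + r • e) - u x)‖ₑ := by simp
    _ ≤ ‖u (x + r • e)‖ₑ + ‖u (x + r • e) - u x‖ₑ := enorm_sub_le
    _ ≤ _ := by
      rw [hray r]
      gcongr
      refine key.trans ?_
      rw [← restrict_Ioc_eq_restrict_Icc]
      refine lintegral_mono fun s => ?_
      rw [(hline s).deriv, hray s]
      refine (ContinuousLinearMap.le_opENorm _ _).trans ?_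
      rw [← ofReal_norm e, hn]; simp

lemma two_pi_mul_enorm_le {u : Plane → ℂ} (hu : ContDiff ℝ 1 u) (x : Plane) {ρ : ℝ}
    (hρ : 0 < ρ) (hρ1 : ρ ≤ 1) :
    ENNReal.ofReal (2 * π) * ‖u x‖ₑ ≤
      (∫⁻ p in Set.Ioc 1 2 ×ˢ Set.Ioo (-π) π, ‖u (x + ray p)‖ₑ) +
      (∫⁻ p in Set.Ioc ρ 2 ×ˢ Set.Ioo (-π) π, ‖fderiv ℝ u (x + ray p)‖ₑ) +
      ∫⁻ p in Set.Ioc 0 ρ ×ˢ Set.Ioo (-π) π, ‖fderiv ℝ u (x + ray p)‖ₑ := by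
  have hcr := continuous_ray
  have hGc : Continuous fun y => fderiv ℝ u y := hu.continuous_fderiv (by norm_num)
  have huc := hu.continuous
  have hGm : Measurable fun p : ℝ × ℝ => ‖fderiv ℝ u (x + ray p)‖ₑ := by
    have : Continuous fun p : ℝ × ℝ => fderiv ℝ u (x + ray p) := by fun_prop
    exact this.enorm.measurable
  have hum : Measurable fun p : ℝ × ℝ => ‖u (x + ray p)‖ₑ := by
    have : Continuous fun p : ℝ × ℝ => u (x + ray p) := by fun_prop
    exact this.enorm.measurable
  have hsplit : ∫⁻ p in Set.Ioc 0 2 ×ˢ Set.Ioo (-π) π, ‖fderiv ℝ u (x + ray p)‖ₑ =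
      (∫⁻ p in Set.Ioc ρ 2 ×ˢ Set.Ioo (-π) π, ‖fderiv ℝ u (x + ray p)‖ₑ) +
      ∫⁻ p in Set.Ioc 0 ρ ×ˢ Set.Ioo (-π) π, ‖fderiv ℝ u (x + ray p)‖ₑ := by
    rw [← Set.Ioc_union_Ioc_eq_Ioc hρ.le (hρ1.trans one_le_two), Set.union_prod,
      lintegral_union (measurableSet_Ioc.prod measurableSet_Ioo), add_comm]
    exact Set.Disjoint.set_prod_left
      (Set.Ioc_disjoint_Ioc_of_le le_rfl) _ _
  rw [add_assoc, ← hsplit]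
  have hvol : volume (Set.Ioc (1:ℝ) 2 ×ˢ Set.Ioo (-π) π) = ENNReal.ofReal (2 * π) := by
    rw [Measure.volume_eq_prod, Measure.prod_prod]
    simp only [Real.volume_Ioc, Real.volume_Ioo]
    rw [← ENNReal.ofReal_mul (by norm_num)]
    congr 1; ring
  have hG2 : ∫⁻ p in Set.Ioc (1:ℝ) 2 ×ˢ Set.Ioo (-π) π,
      ∫⁻ s in Set.Ioc (0:ℝ) 2, ‖fderiv ℝ u (x + ray (s, p.2))‖ₑ =
      ∫⁻ p in Set.Ioc 0 2 ×ˢ Set.Ioo (-π) π, ‖fderiv ℝ u (x + ray p)‖ₑ := by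
    simp only [Measure.volume_eq_prod, ← Measure.prod_restrict]
    rw [lintegral_prod_symm' _ hGm]
    have hm : Measurable fun θ : ℝ =>
        ∫⁻ s in Set.Ioc (0:ℝ) 2, ‖fderiv ℝ u (x + ray (s, θ))‖ₑ := hGm.lintegral_prod_left'
    refine (lintegral_prod_symm' _ (hm.comp measurable_snd)).trans ?_
    simp
    norm_num
  calc ENNReal.ofReal (2 * π) * ‖u x‖ₑ
      = ∫⁻ p in Set.Ioc (1:ℝ) 2 ×ˢ Set.Ioo (-π) π, ‖u x‖ₑ := by
        rw [setLIntegral_const, hvol, mul_comm]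
    _ ≤ ∫⁻ p in Set.Ioc 1 2 ×ˢ Set.Ioo (-π) π, (‖u (x + ray p)‖ₑ +
          ∫⁻ s in Set.Ioc 0 2, ‖fderiv ℝ u (x + ray (s, p.2))‖ₑ) := by
        refine setLIntegral_mono' (measurableSet_Ioc.prod measurableSet_Ioo) fun p hp => ?_
        refine (enorm_le_add_lintegral_ray hu x (r := p.1) (θ := p.2)
          (zero_le_one.trans hp.1.1.le)).trans ?_
        exact add_le_add_right (lintegral_mono_set (Set.Ioc_subset_Ioc_right hp.1.2)) _
    _ = _ := by rw [lintegral_add_left hum, hG2]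

lemma setLIntegral_ray_le {G : Plane → ℝ≥0∞} (hG : Measurable G) (E : Set Plane) {ρ : ℝ}
    (hρ : 0 ≤ ρ) :
    ∫⁻ x in E, ∫⁻ p in Set.Ioc 0 ρ ×ˢ Set.Ioo (-π) π, G (x + ray p) ≤
      ENNReal.ofReal (2 * π * ρ) * (volume E ^ (1 / 2 : ℝ) *
        (∫⁻ y, G y ^ 2) ^ (1 / 2 : ℝ)) := by
  have hm : Measurable fun q : Plane × (ℝ × ℝ) => G (q.1 + ray q.2) :=
    hG.comp (measurable_fst.add (continuous_ray.measurable.comp measurable_snd))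
  rw [lintegral_lintegral_swap hm.aemeasurable]
  have hvol : volume (Set.Ioc (0:ℝ) ρ ×ˢ Set.Ioo (-π) π) = ENNReal.ofReal (2 * π * ρ) := by
    rw [Measure.volume_eq_prod, Measure.prod_prod]
    simp only [Real.volume_Ioc, Real.volume_Ioo, sub_zero]
    rw [← ENNReal.ofReal_mul hρ]
    congr 1; ring
  rw [← hvol, mul_comm, ← setLIntegral_const]
  refine lintegral_mono fun p => ?_
  have hGp : Measurable fun x => G (x + ray p) := hG.comp (measurable_add_const _)
  calc ∫⁻ x in E, G (x + ray p) = ∫⁻ x in E, 1 * G (x + ray p) := by simp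
    _ ≤ _ := lintegral_mul_le_sqrt (by fun_prop) hGp.aemeasurable
    _ ≤ _ := by
      refine mul_le_mul' (ENNReal.rpow_le_rpow ?_ (by norm_num))
        (ENNReal.rpow_le_rpow ?_ (by norm_num))
      · simp
      · refine (setLIntegral_le_lintegral _ _).trans ?_
        rw [lintegral_add_right_eq_self (fun x => G x ^ 2)]

lemma ofReal_rpow_half {a : ℝ} (ha : 0 ≤ a) :
    ENNReal.ofReal a ^ (1 / 2 : ℝ) = ENNReal.ofReal (√a) := by
  rw [ENNReal.ofReal_rpow_of_nonneg ha (by norm_num), Real.sqrt_eq_rpow]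

lemma exp_bound_of_sqrt_bound {B H κ M m t : ℝ} (hH : 0 < H) (hκ : H < κ) (hM : 0 < M)
    (hm : 0 < m) (hmM : m ≤ M) (ht : 0 ≤ t)
    (h : 2 * π * t ≤ B + √(π * H * Real.log (4 * M / m))) :
    m ≤ 4 * M * Real.exp (B ^ 2 / (π * (κ - H))) * Real.exp (-(4 * π * t ^ 2 / κ)) := by
  have hpi := Real.pi_pos
  have hκ0 : 0 < κ := hH.trans hκ
  have hd : 0 < κ - H := sub_pos.2 hκ
  set ℓ := Real.log (4 * M / m) with hℓ
  have hℓ0 : 0 ≤ ℓ := Real.log_nonneg (by rw [le_div_iff₀ hm]; linarith)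
  set y := √(π * H * ℓ) with hy
  have hy2 : y ^ 2 = π * H * ℓ := Real.sq_sqrt (by positivity)
  have h1 : (2 * π * t) ^ 2 ≤ (B + y) ^ 2 := by gcongr
  have h2 : (B + y) ^ 2 ≤ κ / (κ - H) * B ^ 2 + κ / H * y ^ 2 := by
    have : κ / (κ - H) * B ^ 2 + κ / H * y ^ 2 - (B + y) ^ 2 =
        (H * B - (κ - H) * y) ^ 2 / (H * (κ - H)) := by
      field_simp; ring
    have h3 : 0 ≤ (H * B - (κ - H) * y) ^ 2 / (H * (κ - H)) := by positivity
    linarith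
  have h4 : 4 * π * t ^ 2 / κ ≤ B ^ 2 / (π * (κ - H)) + ℓ := by
    have h5 : (2 * π * t) ^ 2 ≤ κ / (κ - H) * B ^ 2 + κ * π * ℓ := by
      refine h1.trans (h2.trans (le_of_eq ?_))
      rw [hy2]; field_simp
    have h6 : 4 * π * t ^ 2 / κ = (2 * π * t) ^ 2 / (π * κ) := by field_simp; ring
    rw [h6, div_le_iff₀ (by positivity)]
    refine h5.trans (le_of_eq ?_)
    field_simp
  have h7 : m = 4 * M * Real.exp (-ℓ) := by
    rw [Real.exp_neg, hℓ, Real.exp_log (by positivity)]; field_simp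
  rw [h7, mul_assoc (4 * M) (Real.exp (B ^ 2 / _)), ← Real.exp_add]
  gcongr
  linarith

lemma volume_level_le {H M κ : ℝ} (hH : 0 < H) (hM : 0 < M) (hκ : H < κ) :
    ∃ C : ℝ, 0 < C ∧ ∀ u : Plane → ℂ, ContDiff ℝ 1 u →
      ∫⁻ x, ‖u x‖ₑ ^ 2 ≤ ENNReal.ofReal M →
      ∫⁻ x, ‖fderiv ℝ u x‖ₑ ^ 2 ≤ ENNReal.ofReal H →
      ∀ t : ℝ, 1 ≤ t →
        volume {x | t ≤ ‖u x‖} ≤ ENNReal.ofReal (C * Real.exp (-(4 * π * t ^ 2 / κ))) := by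
  have hpi := Real.pi_pos
  set B := √M * √(2 * π * Real.log 2) + 2 * π * √H / √M with hB
  refine ⟨4 * M * Real.exp (B ^ 2 / (π * (κ - H))), by positivity,
    fun u hu huM huH t ht => ?_⟩
  have ht0 : 0 < t := zero_lt_one.trans_le ht
  set E := {x | t ≤ ‖u x‖} with hE
  have hEm : MeasurableSet E := measurableSet_le measurable_const hu.continuous.norm.measurable
  have huE : ∀ x ∈ E, ENNReal.ofReal t ≤ ‖u x‖ₑ := by
    intro x hx
    rw [← ofReal_norm]
    exact ENNReal.ofReal_le_ofReal hx
  have hEM : volume E ≤ ENNReal.ofReal M := by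
    calc volume E = ∫⁻ _ in E, 1 := by simp
      _ ≤ ∫⁻ x in E, ‖u x‖ₑ ^ 2 := by
        refine setLIntegral_mono' hEm fun x hx => ?_
        refine one_le_pow₀ (le_trans ?_ (huE x hx))
        rwa [ENNReal.one_le_ofReal]
      _ ≤ _ := (setLIntegral_le_lintegral _ _).trans huM
  have hEtop : volume E ≠ ⊤ := (hEM.trans_lt ENNReal.ofReal_lt_top).ne
  rcases eq_or_ne (volume E) 0 with hE0 | hE0
  · rw [hE0]; exact zero_le
  set m := (volume E).toReal with hm
  have hEv : volume E = ENNReal.ofReal m := (ENNReal.ofReal_toReal hEtop).symm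
  have hm0 : 0 < m := ENNReal.toReal_pos hE0 hEtop
  have hmM : m ≤ M := ENNReal.toReal_le_of_le_ofReal hM.le hEM
  rw [hEv]
  refine ENNReal.ofReal_le_ofReal (exp_bound_of_sqrt_bound hH hκ hM hm0 hmM ht0.le ?_)
  set ρ := √m / √M with hρ
  have hρ0 : 0 < ρ := by positivity
  have hρ1 : ρ ≤ 1 := (div_le_one (by positivity)).2 (Real.sqrt_le_sqrt hmM)
  have hl2 : 0 ≤ Real.log 2 := Real.log_nonneg one_le_two
  have hlρ : 0 ≤ Real.log (2 / ρ) := Real.log_nonneg (by rw [le_div_iff₀ hρ0]; linarith)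
  have hum : Measurable fun x => ‖u x‖ₑ := hu.continuous.enorm.measurable
  have hGm : Measurable fun x => ‖fderiv ℝ u x‖ₑ :=
    (hu.continuous_fderiv (by norm_num)).enorm.measurable
  have hpt : ∀ x, ENNReal.ofReal (2 * π) * ‖u x‖ₑ ≤
      ENNReal.ofReal (√M * √(2 * π * Real.log 2) + √H * √(2 * π * Real.log (2 / ρ))) +
      ∫⁻ p in Set.Ioc 0 ρ ×ˢ Set.Ioo (-π) π, ‖fderiv ℝ u (x + ray p)‖ₑ := by
    intro x
    refine (two_pi_mul_enorm_le hu x hρ0 hρ1).trans ?_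
    gcongr
    rw [ENNReal.ofReal_add (by positivity) (by positivity),
      ENNReal.ofReal_mul (by positivity), ENNReal.ofReal_mul (by positivity),
      ← ofReal_rpow_half hM.le, ← ofReal_rpow_half hH.le,
      ← ofReal_rpow_half (by positivity), ← ofReal_rpow_half (by positivity)]
    refine add_le_add ((lintegral_ray_le hum x one_pos one_le_two).trans ?_)
      ((lintegral_ray_le hGm x hρ0 (hρ1.trans one_le_two)).trans ?_)
    · rw [div_one]
      gcongr
    · gcongr
  set A := √M * √(2 * π * Real.log 2) + √H * √(2 * π * Real.log (2 / ρ)) with hA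
  have hA0 : 0 ≤ A := by positivity
  have hint : ENNReal.ofReal (2 * π * t * m) ≤ ENNReal.ofReal
      (A * m + 2 * π * ρ * (√m * √H)) := by
    calc ENNReal.ofReal (2 * π * t * m)
        = ∫⁻ _ in E, ENNReal.ofReal (2 * π) * ENNReal.ofReal t := by
          rw [setLIntegral_const, hEv, ENNReal.ofReal_mul (by positivity),
            ENNReal.ofReal_mul (by positivity)]
      _ ≤ ∫⁻ x in E, (ENNReal.ofReal A +
            ∫⁻ p in Set.Ioc 0 ρ ×ˢ Set.Ioo (-π) π, ‖fderiv ℝ u (x + ray p)‖ₑ) := by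
          refine setLIntegral_mono' hEm fun x hx => le_trans ?_ (hpt x)
          gcongr
          exact huE x hx
      _ ≤ _ := by
          rw [lintegral_add_left measurable_const, setLIntegral_const, hEv,
            ENNReal.ofReal_add (p := A * m) (by positivity) (by positivity),
            ENNReal.ofReal_mul (q := m) (by positivity),
            ENNReal.ofReal_mul (q := √m * √H) (by positivity),
            ENNReal.ofReal_mul (q := √H) (by positivity)]
          refine add_le_add le_rfl ((setLIntegral_ray_le hGm E hρ0.le).trans ?_)
          rw [hEv, ofReal_rpow_half hm0.le, ← ofReal_rpow_half hH.le]
          gcongr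
  have hreal := (ENNReal.ofReal_le_ofReal_iff (by positivity)).1 hint
  have hlog : Real.log (4 * M / m) = 2 * Real.log (2 / ρ) := by
    have : 4 * M / m = (2 / ρ) ^ 2 := by
      rw [hρ, div_pow, div_pow, Real.sq_sqrt hm0.le, Real.sq_sqrt hM.le]
      field_simp; norm_num
    rw [this, Real.log_pow]; norm_num
  have hs : √(π * H * Real.log (4 * M / m)) = √H * √(2 * π * Real.log (2 / ρ)) := by
    rw [hlog, ← Real.sqrt_mul hH.le]
    congr 1; ring
  rw [hs]
  have hnear : 2 * π * ρ * (√m * √H) = 2 * π * √H / √M * m := by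
    rw [hρ]
    nth_rewrite 3 [← Real.sq_sqrt hm0.le]
    field_simp
  rw [hnear] at hreal
  refine le_of_mul_le_mul_right (hreal.trans (le_of_eq ?_)) hm0
  rw [hA, hB]; ring

lemma exp_sub_one_le_mul_exp (a : ℝ) : Real.exp a - 1 ≤ a * Real.exp a := by
  have h := Real.add_one_le_exp (-a)
  have h2 : Real.exp (-a) * Real.exp a = 1 := by rw [← Real.exp_add]; simp
  nlinarith [Real.exp_pos a]

lemma lintegral_exp_sub_one_le {M κ C : ℝ} (hM : 0 < M) (hκ : 0 < κ) (hκ1 : κ < 1)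
    (hC : 0 < C) :
    ∃ K : ℝ, 0 < K ∧ ∀ u : Plane → ℂ, Continuous u →
      ∫⁻ x, ‖u x‖ₑ ^ 2 ≤ ENNReal.ofReal M →
      (∀ t : ℝ, 1 ≤ t →
        volume {x | t ≤ ‖u x‖} ≤ ENNReal.ofReal (C * Real.exp (-(4 * π * t ^ 2 / κ)))) →
      ∫⁻ x, ENNReal.ofReal (Real.exp (4 * π * ‖u x‖ ^ 2) - 1) ≤ ENNReal.ofReal K := by
  have hpi := Real.pi_pos
  set q := Real.exp (4 * π * (1 - 1 / κ)) with hq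
  have hq1 : q < 1 := by
    rw [hq, Real.exp_lt_one_iff]
    have : 1 < 1 / κ := (one_lt_div hκ).2 hκ1
    nlinarith
  have hq0 : 0 < q := Real.exp_pos _
  have hsum : Summable fun k : ℕ => C * Real.exp (4 * π) * q ^ (k + 1) :=
    (((summable_nat_add_iff 1).2 (summable_geometric_of_lt_one hq0.le hq1))).mul_left _
  refine ⟨4 * π * Real.exp (4 * π) * M + ∑' k : ℕ, C * Real.exp (4 * π) * q ^ (k + 1),
    ?_, fun u hu huM hlev => ?_⟩
  · have : 0 ≤ ∑' k : ℕ, C * Real.exp (4 * π) * q ^ (k + 1) :=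
      tsum_nonneg fun k => by positivity
    positivity
  have hms : ∀ k : ℕ, MeasurableSet {x | √((k:ℝ) + 1) ≤ ‖u x‖} := fun k =>
    measurableSet_le measurable_const hu.norm.measurable
  have hum : Measurable fun x => ‖u x‖ₑ := hu.enorm.measurable
  calc ∫⁻ x, ENNReal.ofReal (Real.exp (4 * π * ‖u x‖ ^ 2) - 1)
      ≤ ∫⁻ x, (ENNReal.ofReal (4 * π * Real.exp (4 * π)) * ‖u x‖ₑ ^ 2 +
          ∑' k : ℕ, {x | √((k:ℝ) + 1) ≤ ‖u x‖}.indicator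
            (fun _ => ENNReal.ofReal (Real.exp (4 * π * (k + 2)))) x) := by
        refine lintegral_mono fun x => ?_
        rcases le_total ‖u x‖ 1 with h1 | h1
        · refine le_trans ?_ le_self_add
          rw [← ofReal_norm, ← ENNReal.ofReal_pow (norm_nonneg _),
            ← ENNReal.ofReal_mul (by positivity)]
          refine ENNReal.ofReal_le_ofReal ((exp_sub_one_le_mul_exp _).trans ?_)
          have h2 : ‖u x‖ ^ 2 ≤ 1 := pow_le_one₀ (norm_nonneg _) h1
          have h3 : Real.exp (4 * π * ‖u x‖ ^ 2) ≤ Real.exp (4 * π) :=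
            Real.exp_le_exp.2 (by nlinarith)
          have h4 : 0 ≤ 4 * π * ‖u x‖ ^ 2 := by positivity
          nlinarith
        · refine le_trans ?_ le_add_self
          have h2 : 1 ≤ ‖u x‖ ^ 2 := one_le_pow₀ h1
          have hfl : 1 ≤ ⌊‖u x‖ ^ 2⌋₊ := Nat.le_floor (by simpa using h2)
          obtain ⟨k, hk⟩ := Nat.exists_eq_add_of_le' hfl
          have hk1 : (k:ℝ) + 1 ≤ ‖u x‖ ^ 2 := by
            have := Nat.floor_le (sq_nonneg ‖u x‖)
            rw [hk] at this; exact_mod_cast this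
          have hk2 : ‖u x‖ ^ 2 < (k:ℝ) + 2 := by
            have := Nat.lt_floor_add_one (‖u x‖ ^ 2)
            rw [hk] at this; push_cast at this; linarith
          refine le_trans ?_ (ENNReal.le_tsum k)
          have hmem : x ∈ {x | √((k:ℝ) + 1) ≤ ‖u x‖} :=
            (Real.sqrt_le_left (norm_nonneg _)).2 hk1
          rw [Set.indicator_of_mem hmem]
          refine ENNReal.ofReal_le_ofReal ?_
          have h3 : Real.exp (4 * π * ‖u x‖ ^ 2) ≤ Real.exp (4 * π * (k + 2)) :=
            Real.exp_le_exp.2 (by nlinarith)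
          linarith
    _ = ENNReal.ofReal (4 * π * Real.exp (4 * π)) * (∫⁻ x, ‖u x‖ₑ ^ 2) +
          ∑' k : ℕ, ENNReal.ofReal (Real.exp (4 * π * (k + 2))) *
            volume {x | √((k:ℝ) + 1) ≤ ‖u x‖} := by
        rw [lintegral_add_left ((hum.pow_const 2).const_mul _),
          lintegral_const_mul _ (hum.pow_const 2),
          lintegral_tsum fun k => (measurable_const.indicator (hms k)).aemeasurable]
        simp_rw [lintegral_indicator_const (hms _)]
    _ ≤ ENNReal.ofReal (4 * π * Real.exp (4 * π)) * ENNReal.ofReal M +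
          ∑' k : ℕ, ENNReal.ofReal (C * Real.exp (4 * π) * q ^ (k + 1)) := by
        refine add_le_add (mul_le_mul' le_rfl huM) (ENNReal.tsum_le_tsum fun k => ?_)
        have h1 := hlev (√((k:ℝ) + 1)) (by rw [Real.one_le_sqrt]; simp)
        refine (mul_le_mul' le_rfl h1).trans (le_of_eq ?_)
        rw [← ENNReal.ofReal_mul (Real.exp_pos _).le, Real.sq_sqrt (by positivity), hq,
          ← Real.exp_nat_mul]
        congr 1
        rw [mul_left_comm, ← Real.exp_add, mul_assoc C, ← Real.exp_add]
        congr 2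
        push_cast; field_simp; ring
    _ = _ := by
        rw [ENNReal.ofReal_add (by positivity) (tsum_nonneg fun k => by positivity),
          ENNReal.ofReal_mul (q := M) (by positivity),
          ENNReal.ofReal_tsum_of_nonneg (fun k => by positivity) hsum]

lemma sq_norm_le_log {κ C α ε : ℝ} (hκ : 0 < κ) (hC : 0 < C) (hα : 0 < α) (hε : 0 < ε) :
    ∃ K : ℝ, ∀ u : Plane → ℂ,
      (∀ t : ℝ, 1 ≤ t →
        volume {x | t ≤ ‖u x‖} ≤ ENNReal.ofReal (C * Real.exp (-(4 * π * t ^ 2 / κ)))) →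
      ∀ N : ℝ, 1 ≤ N → (∀ x y, ‖u x - u y‖ ≤ N * ‖x - y‖ ^ α) →
      ∀ x, 4 * π * ‖u x‖ ^ 2 ≤ K + (1 + ε) * (2 * κ / α) * Real.log N := by
  have hpi := Real.pi_pos
  refine ⟨16 * π + (1 + ε) * κ * |Real.log (C / π)| + 4 * π * (1 + 1 / ε),
    fun u hlev N hN hu x => ?_⟩
  have hN0 : 0 < N := zero_lt_one.trans_le hN
  have hlogN : 0 ≤ Real.log N := Real.log_nonneg hN
  have hrest : 0 ≤ (1 + ε) * κ * |Real.log (C / π)| := by positivity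
  have hrest2 : 0 ≤ 4 * π * (1 + 1 / ε) := by positivity
  have hrest3 : 0 ≤ (1 + ε) * (2 * κ / α) * Real.log N := by positivity
  rcases le_total ‖u x‖ 2 with h2 | h2
  · have : ‖u x‖ ^ 2 ≤ 4 := by nlinarith [norm_nonneg (u x)]
    nlinarith
  set t := ‖u x‖ - 1 with ht
  have ht1 : 1 ≤ t := by linarith
  set r := N ^ (-1 / α) with hr
  have hr0 : 0 < r := Real.rpow_pos_of_pos hN0 _
  have hsub : Metric.ball x r ⊆ {y | t ≤ ‖u y‖} := by
    intro y hy
    have h3 : ‖x - y‖ ^ α ≤ r ^ α := by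
      refine Real.rpow_le_rpow (norm_nonneg _) ?_ hα.le
      rw [← dist_eq_norm, dist_comm]; exact (Metric.mem_ball.1 hy).le
    have h4 : N * r ^ α = 1 := by
      rw [hr, ← Real.rpow_mul hN0.le, div_mul_cancel₀ _ hα.ne', Real.rpow_neg_one,
        mul_inv_cancel₀ hN0.ne']
    have h5 : ‖u x - u y‖ ≤ 1 := (hu x y).trans (by rw [← h4]; gcongr)
    have h6 := norm_sub_norm_le (u x) (u y)
    change t ≤ ‖u y‖
    linarith
  have hvol := (measure_mono hsub).trans (hlev t ht1)
  rw [EuclideanSpace.volume_ball_fin_two, ← ENNReal.ofReal_pow hr0.le,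
    ← ENNReal.ofReal_mul (by positivity),
    ENNReal.ofReal_le_ofReal_iff (by positivity)] at hvol
  have hvol' : r ^ 2 ≤ C / π * Real.exp (-(4 * π * t ^ 2 / κ)) := by
    have h7 : r ^ 2 * π ≤ C * Real.exp (-(4 * π * t ^ 2 / κ)) := hvol
    rw [div_mul_eq_mul_div, le_div_iff₀ hpi]
    exact h7
  have hlog := Real.log_le_log (by positivity) hvol'
  rw [Real.log_mul (by positivity) (Real.exp_ne_zero _), Real.log_exp, Real.log_pow, hr,
    Real.log_rpow hN0] at hlog
  push_cast at hlog
  have habs := le_abs_self (Real.log (C / π))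
  have h8 : 4 * π * t ^ 2 ≤ κ * |Real.log (C / π)| + 2 * κ / α * Real.log N := by
    have h9 : 4 * π * t ^ 2 / κ ≤ |Real.log (C / π)| + 2 / α * Real.log N := by
      have : 2 * (-1 / α * Real.log N) = -(2 / α * Real.log N) := by ring
      linarith
    rw [div_le_iff₀ hκ] at h9
    refine h9.trans (le_of_eq ?_); ring
  have h10 : ‖u x‖ ^ 2 ≤ (1 + ε) * t ^ 2 + (1 + 1 / ε) := by
    have h11 : ‖u x‖ = t + 1 := by rw [ht]; ring
    have h12 : (1 + ε) * t ^ 2 + (1 + 1 / ε) - (t + 1) ^ 2 = (ε * t - 1) ^ 2 / ε := by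
      field_simp; ring
    have h13 : 0 ≤ (ε * t - 1) ^ 2 / ε := by positivity
    rw [h11]; linarith
  calc 4 * π * ‖u x‖ ^ 2 ≤ 4 * π * ((1 + ε) * t ^ 2 + (1 + 1 / ε)) := by gcongr
    _ = (1 + ε) * (4 * π * t ^ 2) + 4 * π * (1 + 1 / ε) := by ring
    _ ≤ (1 + ε) * (κ * |Real.log (C / π)| + 2 * κ / α * Real.log N) + 4 * π * (1 + 1 / ε) := by
      gcongr
    _ ≤ _ := by nlinarith

lemma norm_fderiv_fC_comp_le {u : Plane → ℂ} {x : Plane} (hu : DifferentiableAt ℝ u x) :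
    ‖fderiv ℝ (fun y => fC (u y)) x‖ ≤
      12 * π * (‖fderiv ℝ u x‖ * ‖u x‖ ^ 2 * (Real.exp (4 * π * ‖u x‖ ^ 2) - 1)) := by
  have hpi := Real.pi_pos
  set s := ‖u x‖ ^ 2 with hs
  have hs0 : 0 ≤ s := sq_nonneg _
  have h1 : HasFDerivAt (fun y => ‖u y‖ ^ 2) _ x := hu.hasFDerivAt.norm_sq
  have h2 : HasDerivAt (fun s : ℝ => Real.exp (4 * π * s) - 1 - 4 * π * s)
      (4 * π * (Real.exp (4 * π * s) - 1)) s := by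
    have h3 : HasDerivAt (fun s : ℝ => 4 * π * s) (4 * π) s := by
      simpa using (hasDerivAt_id s).const_mul (4 * π)
    exact ((h3.exp.sub_const 1).sub h3).congr_deriv (by ring)
  have h4 := (h2.comp_hasFDerivAt x h1).smul hu.hasFDerivAt
  have h5 : (fun y => fC (u y)) = fun y =>
      (Real.exp (4 * π * ‖u y‖ ^ 2) - 1 - 4 * π * ‖u y‖ ^ 2) • u y := by
    funext y
    rw [fC, Complex.real_smul]
  have h6 := h4.congr_of_eventuallyEq (f₁ := fun y => fC (u y))
    (.of_forall fun y => congrFun h5 y)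
  rw [h6.fderiv]
  have hW : 0 ≤ Real.exp (4 * π * s) - 1 := by
    have := Real.one_le_exp (x := 4 * π * s) (by positivity)
    linarith
  have hφ : |Real.exp (4 * π * s) - 1 - 4 * π * s| ≤
      4 * π * s * (Real.exp (4 * π * s) - 1) := by
    rw [abs_of_nonneg (by linarith [Real.add_one_le_exp (4 * π * s)])]
    linarith [exp_sub_one_le_mul_exp (4 * π * s)]
  have hin : ‖(innerSL ℝ (u x)).comp (fderiv ℝ u x)‖ ≤ ‖u x‖ * ‖fderiv ℝ u x‖ := by
    refine (ContinuousLinearMap.opNorm_comp_le _ _).trans ?_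
    rw [innerSL_apply_norm]
  refine (norm_add_le _ _).trans ?_
  rw [ContinuousLinearMap.norm_smulRight_apply, norm_smul, norm_smul, two_smul,
    Function.comp_apply, Real.norm_eq_abs, Real.norm_eq_abs,
    abs_of_nonneg (mul_nonneg (by positivity : 0 ≤ 4 * π) hW)]
  have h7 := norm_add_le ((innerSL ℝ (u x)).comp (fderiv ℝ u x))
    ((innerSL ℝ (u x)).comp (fderiv ℝ u x))
  calc _ ≤ 4 * π * s * (Real.exp (4 * π * s) - 1) * ‖fderiv ℝ u x‖ +
        4 * π * (Real.exp (4 * π * s) - 1) *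
          (‖u x‖ * ‖fderiv ℝ u x‖ + ‖u x‖ * ‖fderiv ℝ u x‖) * ‖u x‖ := by
        gcongr
        exact h7.trans (add_le_add hin hin)
    _ = _ := by rw [hs]; ring

lemma lintegral_mul_mul_rpow_le {X : Type*} [MeasurableSpace X] {μ : Measure X}
    {f g h : X → ℝ≥0∞} (hf : Measurable f) (hg : Measurable g) (hh : Measurable h)
    {a b c : ℝ} (ha : 0 ≤ a) (hb : 0 ≤ b) (hc : 0 ≤ c) (habc : a + b + c = 1) :
    ∫⁻ x, f x ^ a * g x ^ b * h x ^ c ∂μ ≤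
      (∫⁻ x, f x ∂μ) ^ a * (∫⁻ x, g x ∂μ) ^ b * (∫⁻ x, h x ∂μ) ^ c := by
  have key := ENNReal.lintegral_prod_norm_pow_le (μ := μ) Finset.univ
    (f := ![f, g, h]) (p := ![a, b, c])
    (fun i _ => by fin_cases i <;> simp [hf.aemeasurable, hg.aemeasurable, hh.aemeasurable])
    (by simpa [Fin.sum_univ_three] using habc)
    (fun i _ => by fin_cases i <;> simp [ha, hb, hc])
  simpa [Fin.prod_univ_three] using key

lemma norm_sub_le_holderNormC {α : ℝ} {u : Plane → ℂ} (hα : 0 < α) (hu : IsHolderC α u)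
    (x y : Plane) : ‖u x - u y‖ ≤ max 1 (holderNormC α u) * ‖x - y‖ ^ α := by
  rcases eq_or_ne x y with rfl | hxy
  · simp [Real.zero_rpow hα.ne']
  obtain ⟨C, hC, hu⟩ := hu
  have hpos : ∀ {x y : Plane}, x ≠ y → 0 < ‖x - y‖ ^ α := fun h =>
    Real.rpow_pos_of_pos (norm_pos_iff.2 (sub_ne_zero.2 h)) α
  have hbdd : BddAbove (Set.range fun p : Plane × Plane =>
      if p.1 = p.2 then 0 else ‖u p.1 - u p.2‖ / ‖p.1 - p.2‖ ^ α) := by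
    refine ⟨C, ?_⟩
    rintro _ ⟨p, rfl⟩
    dsimp only
    split_ifs with h
    · exact hC
    · exact (div_le_iff₀ (hpos h)).2 (hu _ _)
  have h1 := le_ciSup hbdd (x, y)
  simp only [if_neg hxy] at h1
  have h2 : 0 ≤ ⨆ x : Plane, ‖u x‖ := Real.iSup_nonneg fun x => norm_nonneg _
  rw [← div_le_iff₀ (hpos hxy)]
  refine le_max_of_le_right (h1.trans ?_)
  rw [holderNormC]
  linarith

lemma lintegral_enorm_sq_le {E : Type*} [NormedAddCommGroup E] {v : Plane → E} {A : ℝ}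
    (hv : Integrable fun x => ‖v x‖ ^ 2) (hA : ∫ x, ‖v x‖ ^ 2 ≤ A) :
    ∫⁻ x, ‖v x‖ₑ ^ 2 ≤ ENNReal.ofReal A := by
  refine le_trans (le_of_eq ?_) (ENNReal.ofReal_le_ofReal hA)
  rw [ofReal_integral_eq_lintegral_ofReal hv (ae_of_all _ fun x => sq_nonneg _)]
  refine lintegral_congr fun x => ?_
  rw [ENNReal.ofReal_pow (norm_nonneg _), ofReal_norm]

/-- Hölder's inequality for the product `g |u|² (e^{4π|u|²} - 1)` once the growth of the
exponential beyond the power `1/2 - δ` has been bounded by a constant `S`. -/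
lemma integral_fderiv_fC_rpow_le {δ S K : ℝ} (hδ0 : 0 < δ) (hδ1 : δ < 1 / 2) (hS : 0 < S)
    (hK : 0 < K) {u : Plane → ℂ} (hu : ContDiff ℝ 1 u)
    (hI2 : Integrable fun x => ‖u x‖ ^ (4 / δ))
    (hI1 : Integrable fun x => gradNormC u x ^ (2 / (1 - δ)))
    (hI3 : ∫⁻ x, ENNReal.ofReal (Real.exp (4 * π * ‖u x‖ ^ 2) - 1) ≤ ENNReal.ofReal K)
    (hSu : ∀ x, Real.exp ((1 / 2 + δ) * (4 * π * ‖u x‖ ^ 2)) ≤ S) :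
    (∫ x : Plane, ‖fderiv ℝ (fun y => fC (u y)) x‖ ^ (1 / (1 - δ))) ^ (1 - δ) ≤
      12 * π * S * (∫ x : Plane, gradNormC u x ^ (2 / (1 - δ))) ^ ((1 - δ) / 2) *
        ((∫ x : Plane, ‖u x‖ ^ (4 / δ)) ^ (δ / 4)) ^ 2 * K ^ (1 / 2 - δ) := by
  have hpi := Real.pi_pos
  have hδ2 : 0 < 1 - δ := by linarith
  set p := 1 / (1 - δ) with hp
  have hp0 : 0 < p := by positivity
  set A := ∫ x : Plane, gradNormC u x ^ (2 / (1 - δ)) with hA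
  set B := ∫ x : Plane, ‖u x‖ ^ (4 / δ) with hB
  have hA0 : 0 ≤ A := integral_nonneg fun x => Real.rpow_nonneg (norm_nonneg _) _
  have hB0 : 0 ≤ B := integral_nonneg fun x => Real.rpow_nonneg (norm_nonneg _) _
  have hw : 0 ≤ p * (1 / 2 - δ) := mul_nonneg hp0.le (by linarith)
  have hGm : Measurable fun x => gradNormC u x :=
    (hu.continuous_fderiv (by norm_num)).norm.measurable
  have hum : Measurable fun x => ‖u x‖ := hu.continuous.norm.measurable
  have hpt : ∀ x, ENNReal.ofReal (‖fderiv ℝ (fun y => fC (u y)) x‖ ^ p) ≤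
      ENNReal.ofReal ((12 * π * S) ^ p) *
      (ENNReal.ofReal (gradNormC u x ^ (2 / (1 - δ))) ^ (1 / 2 : ℝ) *
      ENNReal.ofReal (‖u x‖ ^ (4 / δ)) ^ (p * δ / 2) *
      ENNReal.ofReal (Real.exp (4 * π * ‖u x‖ ^ 2) - 1) ^ (p * (1 / 2 - δ))) := by
    intro x
    set W := Real.exp (4 * π * ‖u x‖ ^ 2) - 1 with hW
    have hW0 : 0 ≤ W := by
      have := Real.one_le_exp (x := 4 * π * ‖u x‖ ^ 2) (by positivity)
      linarith
    have hg0 : 0 ≤ gradNormC u x := norm_nonneg _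
    have hWS : W ≤ S * W ^ (1 / 2 - δ) := by
      calc W = W ^ (1 / 2 + δ) * W ^ (1 / 2 - δ) := by
            rw [← Real.rpow_add_of_nonneg hW0 (by linarith) (by linarith)]
            norm_num
        _ ≤ S * W ^ (1 / 2 - δ) := by
            gcongr
            refine le_trans ?_ (hSu x)
            rw [mul_comm, Real.exp_mul]
            exact Real.rpow_le_rpow hW0 (by rw [hW]; linarith) (by linarith)
    have h1 : ‖fderiv ℝ (fun y => fC (u y)) x‖ ≤
        (12 * π * S) * (gradNormC u x * ‖u x‖ ^ 2 * W ^ (1 / 2 - δ)) := by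
      refine (norm_fderiv_fC_comp_le (hu.differentiable (by norm_num) x)).trans ?_
      calc 12 * π * (gradNormC u x * ‖u x‖ ^ 2 * W)
          ≤ 12 * π * (gradNormC u x * ‖u x‖ ^ 2 * (S * W ^ (1 / 2 - δ))) := by gcongr
        _ = _ := by ring
    have h2 : ‖fderiv ℝ (fun y => fC (u y)) x‖ ^ p ≤
        (12 * π * S) ^ p * ((gradNormC u x ^ (2 / (1 - δ))) ^ (1 / 2 : ℝ) *
          (‖u x‖ ^ (4 / δ)) ^ (p * δ / 2) * W ^ (p * (1 / 2 - δ))) := by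
      refine (Real.rpow_le_rpow (norm_nonneg _) h1 hp0.le).trans (le_of_eq ?_)
      rw [Real.mul_rpow (x := 12 * π * S) (by positivity) (by positivity),
        Real.mul_rpow (x := gradNormC u x * ‖u x‖ ^ 2) (by positivity) (by positivity),
        Real.mul_rpow hg0 (by positivity),
        ← Real.rpow_mul hg0, ← Real.rpow_mul (norm_nonneg _), ← Real.rpow_mul hW0,
        ← Real.rpow_natCast, ← Real.rpow_mul (norm_nonneg _), mul_comm (1 / 2 - δ) p]
      congr 4
      · rw [hp]; field_simp
      · push_cast; field_simp; norm_num
    refine (ENNReal.ofReal_le_ofReal h2).trans (le_of_eq ?_)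
    rw [ENNReal.ofReal_mul (by positivity), ENNReal.ofReal_mul (by positivity),
      ENNReal.ofReal_mul (by positivity),
      ENNReal.ofReal_rpow_of_nonneg (by positivity) (by norm_num),
      ENNReal.ofReal_rpow_of_nonneg (by positivity) (by positivity),
      ENNReal.ofReal_rpow_of_nonneg hW0 hw]
  have hlin : ∫⁻ x, ENNReal.ofReal (‖fderiv ℝ (fun y => fC (u y)) x‖ ^ p) ≤
      ENNReal.ofReal ((12 * π * S) ^ p *
        (A ^ (1 / 2 : ℝ) * B ^ (p * δ / 2) * K ^ (p * (1 / 2 - δ)))) := by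
    have hm1 : Measurable fun x => ENNReal.ofReal (gradNormC u x ^ (2 / (1 - δ))) :=
      (hGm.pow_const _).ennreal_ofReal
    have hm2 : Measurable fun x => ENNReal.ofReal (‖u x‖ ^ (4 / δ)) :=
      (hum.pow_const _).ennreal_ofReal
    have hm3 : Measurable fun x => ENNReal.ofReal (Real.exp (4 * π * ‖u x‖ ^ 2) - 1) := by
      fun_prop
    refine (lintegral_mono hpt).trans ?_
    rw [lintegral_const_mul' _ _ ENNReal.ofReal_ne_top, ENNReal.ofReal_mul (by positivity),
      ENNReal.ofReal_mul (by positivity), ENNReal.ofReal_mul (by positivity),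
      ← ENNReal.ofReal_rpow_of_nonneg hA0 (by norm_num),
      ← ENNReal.ofReal_rpow_of_nonneg hB0 (by positivity),
      ← ENNReal.ofReal_rpow_of_nonneg hK.le hw]
    gcongr
    refine (lintegral_mul_mul_rpow_le hm1 hm2 hm3 (by norm_num) (by positivity) hw
      (by rw [hp]; field_simp; ring)).trans ?_
    rw [hA, hB, ofReal_integral_eq_lintegral_ofReal hI1
        (ae_of_all _ fun x => Real.rpow_nonneg (norm_nonneg _) _),
      ofReal_integral_eq_lintegral_ofReal hI2
        (ae_of_all _ fun x => Real.rpow_nonneg (norm_nonneg _) _)]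
    gcongr
  have hreal : ∫ x : Plane, ‖fderiv ℝ (fun y => fC (u y)) x‖ ^ p ≤
      (12 * π * S) ^ p * (A ^ (1 / 2 : ℝ) * B ^ (p * δ / 2) * K ^ (p * (1 / 2 - δ))) := by
    rw [integral_eq_lintegral_of_nonneg_ae
      (ae_of_all _ fun x => Real.rpow_nonneg (norm_nonneg _) _)
      ((measurable_fderiv ℝ _).norm.pow_const _).aestronglyMeasurable]
    exact ENNReal.toReal_le_of_le_ofReal (by positivity) hlin
  refine (Real.rpow_le_rpow (integral_nonneg fun x => Real.rpow_nonneg (norm_nonneg _) _)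
    hreal hδ2.le).trans (le_of_eq ?_)
  rw [Real.mul_rpow (x := (12 * π * S) ^ p) (by positivity) (by positivity),
    Real.mul_rpow (x := A ^ (1 / 2 : ℝ) * B ^ (p * δ / 2)) (by positivity) (by positivity),
    Real.mul_rpow (x := A ^ (1 / 2 : ℝ)) (by positivity) (by positivity),
    ← Real.rpow_mul (x := 12 * π * S) (by positivity), ← Real.rpow_mul hA0, ← Real.rpow_mul hB0,
    ← Real.rpow_mul hK.le, ← Real.rpow_natCast, ← Real.rpow_mul hB0]
  have e1 : p * (1 - δ) = 1 := by rw [hp]; field_simp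
  have e2 : p * δ / 2 * (1 - δ) = δ / 4 * (2 : ℕ) := by
    push_cast; linear_combination δ / 2 * e1
  have e3 : p * (1 / 2 - δ) * (1 - δ) = 1 / 2 - δ := by linear_combination (1 / 2 - δ) * e1
  have e4 : 1 / 2 * (1 - δ) = (1 - δ) / 2 := by ring
  rw [e1, e2, e3, e4, Real.rpow_one]
  ring

/-- dual Strichartz estimate on `∇f(u)` for NLS (Lemma 8.1, main step). -/
theorem statement17 (H M : ℝ) (hH : H ∈ Set.Ioo (0:ℝ) 1) (hM : 0 < M) :
    ∃ δ ∈ Set.Ioo (0:ℝ) 1, ∃ C : ℝ, 0 < C ∧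
      ∀ u : Plane → ℂ, ContDiff ℝ 1 u →
        Integrable (fun x => ‖u x‖ ^ 2) →
        Integrable (fun x => gradNormC u x ^ 2) →
        (∫ x : Plane, gradNormC u x ^ 2) ≤ H →
        (∫ x : Plane, ‖u x‖ ^ 2) ≤ M →
        Integrable (fun x => ‖u x‖ ^ (4/δ)) →
        Integrable (fun x => gradNormC u x ^ (2/(1-δ))) →
        IsHolderC (1/2 - δ/2) u →
        (∫ x : Plane, ‖fderiv ℝ (fun y => fC (u y)) x‖ ^ (1/(1-δ))) ^ (1-δ) ≤
          C * (∫ x : Plane, gradNormC u x ^ (2/(1-δ))) ^ ((1-δ)/2) *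
            ((∫ x : Plane, ‖u x‖ ^ (4/δ)) ^ (δ/4)) ^ 2 *
            max 1 (holderNormC (1/2 - δ/2) u) ^ 2 := by
  obtain ⟨hH0, hH1⟩ := hH
  have hpi := Real.pi_pos
  set η := (1 - H) / 2 with hη
  have hη0 : 0 < η := by rw [hη]; linarith
  have hη1 : η < 1 / 2 := by rw [hη]; linarith
  have hκ : H < 1 - η := by rw [hη]; linarith
  have hκ0 : 0 < 1 - η := hH0.trans hκ
  set δ := η / 16 with hδ
  have hδ0 : 0 < δ := by positivity
  have hδ1 : δ < 1 / 32 := by rw [hδ]; linarith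
  have hα : 0 < 1 / 2 - δ / 2 := by linarith
  obtain ⟨C₁, hC₁, hlevel⟩ := volume_level_le hH0 hM hκ
  obtain ⟨K, hK, hexp⟩ := lintegral_exp_sub_one_le hM hκ0 (by linarith) hC₁
  obtain ⟨K₂, hsup⟩ := sq_norm_le_log hκ0 hC₁ hα (ε := η / 4) (by positivity)
  refine ⟨δ, ⟨hδ0, by linarith⟩,
    12 * π * Real.exp ((1 / 2 + δ) * K₂) * K ^ (1 / 2 - δ), by positivity, ?_⟩
  intro u hu hi2 hig2 hgH huM hI2 hI1 hhol
  set N := max 1 (holderNormC (1 / 2 - δ / 2) u) with hN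
  have hN1 : 1 ≤ N := le_max_left _ _
  have hN0 : 0 < N := zero_lt_one.trans_le hN1
  have huM' := lintegral_enorm_sq_le hi2 huM
  have hlev := hlevel u hu huM' (lintegral_enorm_sq_le hig2 hgH)
  have hlogN : 0 ≤ Real.log N := Real.log_nonneg hN1
  have hcoef : (1 / 2 + δ) * ((1 + η / 4) * (2 * (1 - η) / (1 / 2 - δ / 2))) ≤ 2 := by
    rw [← mul_div_assoc, ← mul_div_assoc, div_le_iff₀ hα, hδ]
    nlinarith [mul_pos hη0 hη0, mul_pos hη0 (mul_pos hη0 hη0)]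
  have hS : ∀ x, Real.exp ((1 / 2 + δ) * (4 * π * ‖u x‖ ^ 2)) ≤
      Real.exp ((1 / 2 + δ) * K₂) * N ^ 2 := by
    intro x
    have h1 := hsup u hlev N hN1 (norm_sub_le_holderNormC hα hhol) x
    have h2 : N ^ 2 = Real.exp (2 * Real.log N) := by
      rw [mul_comm, Real.exp_mul, Real.exp_log hN0, Real.rpow_two]
    rw [h2, ← Real.exp_add]
    refine Real.exp_le_exp.2 ?_
    calc (1 / 2 + δ) * (4 * π * ‖u x‖ ^ 2)
        ≤ (1 / 2 + δ) * (K₂ + (1 + η / 4) * (2 * (1 - η) / (1 / 2 - δ / 2)) * Real.log N) := by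
          gcongr
      _ = (1 / 2 + δ) * K₂ +
          (1 / 2 + δ) * ((1 + η / 4) * (2 * (1 - η) / (1 / 2 - δ / 2))) * Real.log N := by
          ring
      _ ≤ _ := by gcongr
  refine (integral_fderiv_fC_rpow_le hδ0 (by linarith) (by positivity) hK hu hI2 hI1
    (hexp u hu.continuous huM' hlev) hS).trans (le_of_eq ?_)
  ring
end
end
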